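/- For all δ, ε > 0 with δ ∈ (0,1), ε ∈ (0,1), and δ + ε < 1, it holds that OPT(δ + ε) ≥ OPT(δ) − 2√ε + ε. -/

import Mathlib

open scoped BigOperators

/-- An instance of a hidden-action principal-agent problem with action set `A`
and outcome set `O`. -/
structure PAInstance (A O : Type*) [Fintype A] [Fintype O] [Nonempty A] [Nonempty O] where
  /-- `F a ω` is the probability that action `a` results in outcome `ω`. -/
  F : A → O → ℝ
  /-- principal's reward vector -/
  r : O → ℝ
  /-- agent's cost vector -/
  c : A → ℝ
  F_nonneg : ∀ a ω, 0 ≤ F a ω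
  F_sum : ∀ a, ∑ ω, F a ω = 1
  r_mem : ∀ ω, r ω ∈ Set.Icc (0 : ℝ) 1
  c_mem : ∀ a, c a ∈ Set.Icc (0 : ℝ) 1
  /-- the opt-out action -/
  optOut : A
  optOut_cost : c optOut = 0
  optOut_reward : ∑ ω, F optOut ω * r ω = 0

namespace PAInstance

variable {A O : Type*} [Fintype A] [Fintype O] [Nonempty A] [Nonempty O]

/-- A contract is a vector of nonnegative payments, one per outcome. -/
def IsContract (p : O → ℝ) : Prop := ∀ ω, 0 ≤ p ω

/-- Agent's expected utility `u^A(p, a) = F_a · p - c_a`. -/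
def uA (I : PAInstance A O) (p : O → ℝ) (a : A) : ℝ := (∑ ω, I.F a ω * p ω) - I.c a

/-- Principal's expected utility `u^P(p, a) = F_a · (r - p)`. -/
def uP (I : PAInstance A O) (p : O → ℝ) (a : A) : ℝ := ∑ ω, I.F a ω * (I.r ω - p ω)

/-- The set of (exact) best responses `A(p)`. -/
def BR (I : PAInstance A O) (p : O → ℝ) : Set A := {a | ∀ a', I.uA p a' ≤ I.uA p a}

/-- The set of `δ`-best responses
`A^δ(p) = {a : u^A(p,a) > max_{a'} u^A(p,a') - δ}`. -/
def dBR (I : PAInstance A O) (δ : ℝ) (p : O → ℝ) : Set A :=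
  {a | ∀ a', I.uA p a' - δ < I.uA p a}

/-- `Ψ_δ(p) = min_{a ∈ A^δ(p)} u^P(p, a)`, the principal's robust utility in `p`. -/
noncomputable def Psi (I : PAInstance A O) (δ : ℝ) (p : O → ℝ) : ℝ :=
  sInf (I.uP p '' I.dBR δ p)

/-- `OPT(δ)`: the optimal δ-robust value. -/
noncomputable def OPTrob (I : PAInstance A O) (δ : ℝ) : ℝ :=
  sSup {x | ∃ p, IsContract p ∧ x = I.Psi δ p}

/-- `OPT`: value of an optimal (non-robust) contract, where the agent breaks
ties in favor of the principal. -/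
noncomputable def OPT (I : PAInstance A O) : ℝ :=
  sSup {x | ∃ p, IsContract p ∧ x = sSup (I.uP p '' I.BR p)}

/-- `SW = max_a (F_a · r - c_a)`, the maximum social welfare. -/
noncomputable def SW (I : PAInstance A O) : ℝ :=
  sSup (Set.range fun a => (∑ ω, I.F a ω * I.r ω) - I.c a)

end PAInstance

namespace PAInstance

variable {A O : Type*} [Fintype A] [Fintype O] [Nonempty A] [Nonempty O]

lemma BR_nonempty (I : PAInstance A O) (p : O → ℝ) : (I.BR p).Nonempty :=
  Finite.exists_max (I.uA p)

lemma BR_subset_dBR (I : PAInstance A O) {δ : ℝ} (hδ : 0 < δ) (p : O → ℝ) :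
    I.BR p ⊆ I.dBR δ p := fun _ ha a' => by
  linarith [ha a']

lemma dBR_nonempty (I : PAInstance A O) {δ : ℝ} (hδ : 0 < δ) (p : O → ℝ) :
    (I.dBR δ p).Nonempty :=
  (I.BR_nonempty p).mono (I.BR_subset_dBR hδ p)

lemma uP_le_one (I : PAInstance A O) {p : O → ℝ} (hp : IsContract p) (a : A) :
    I.uP p a ≤ 1 := by
  rw [← I.F_sum a]
  refine Finset.sum_le_sum fun ω _ => mul_le_of_le_one_right (I.F_nonneg a ω) ?_
  linarith [(I.r_mem ω).2, hp ω]

lemma Psi_le (I : PAInstance A O) {δ : ℝ} {p : O → ℝ} {a : A} (ha : a ∈ I.dBR δ p) :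
    I.Psi δ p ≤ I.uP p a :=
  csInf_le (Set.toFinite _).bddBelow (Set.mem_image_of_mem _ ha)

lemma Psi_le_one (I : PAInstance A O) {δ : ℝ} (hδ : 0 < δ) {p : O → ℝ} (hp : IsContract p) :
    I.Psi δ p ≤ 1 := by
  obtain ⟨a, ha⟩ := I.dBR_nonempty hδ p
  exact (I.Psi_le ha).trans (I.uP_le_one hp a)

lemma Psi_le_OPTrob (I : PAInstance A O) {δ : ℝ} (hδ : 0 < δ) {p : O → ℝ}
    (hp : IsContract p) : I.Psi δ p ≤ I.OPTrob δ := by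
  refine le_csSup ⟨1, ?_⟩ ⟨p, hp, rfl⟩
  rintro _ ⟨q, hq, rfl⟩
  exact I.Psi_le_one hδ hq

/-- The contract `p` moved a fraction `α` of the way towards the reward vector. -/
def towardReward (I : PAInstance A O) (α : ℝ) (p : O → ℝ) : O → ℝ :=
  fun ω => p ω + α * (I.r ω - p ω)

lemma isContract_towardReward (I : PAInstance A O) {α : ℝ} (h0 : 0 ≤ α) (h1 : α ≤ 1)
    {p : O → ℝ} (hp : IsContract p) : IsContract (I.towardReward α p) := fun ω => by
  have h₁ := mul_nonneg h0 (I.r_mem ω).1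
  have h₂ := mul_nonneg (sub_nonneg.2 h1) (hp ω)
  simp only [towardReward]
  linarith

lemma uA_towardReward (I : PAInstance A O) (α : ℝ) (p : O → ℝ) (a : A) :
    I.uA (I.towardReward α p) a = I.uA p a + α * I.uP p a := by
  simp only [uA, uP, towardReward, mul_add, Finset.sum_add_distrib, Finset.mul_sum,
    mul_left_comm α]
  ring

lemma uP_towardReward (I : PAInstance A O) (α : ℝ) (p : O → ℝ) (a : A) :
    I.uP (I.towardReward α p) a = (1 - α) * I.uP p a := by
  simp only [uP, towardReward, Finset.mul_sum]
  exact Finset.sum_congr rfl fun ω _ => by ring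

/-- Moving `p` towards the reward makes any `(δ + α²)`-best response almost as good for the
principal as the worst `δ`-best response to `p`. -/
lemma Psi_sub_le_uP_of_mem_dBR (I : PAInstance A O) {δ α : ℝ} (hδ : 0 < δ) (hα : 0 < α)
    {p : O → ℝ} {a : A} (ha : a ∈ I.dBR (δ + α ^ 2) (I.towardReward α p)) :
    I.Psi δ p - α ≤ I.uP p a := by
  by_cases h : a ∈ I.dBR δ p
  · linarith [I.Psi_le h]
  · obtain ⟨b, hb⟩ := I.BR_nonempty p
    simp only [dBR, Set.mem_ofPred_eq, not_forall, not_lt] at h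
    obtain ⟨a', ha'⟩ := h
    have hab := ha b
    rw [uA_towardReward, uA_towardReward] at hab
    have hmul : α * (I.uP p b - α) ≤ α * I.uP p a := by linarith [hb a']
    linarith [le_of_mul_le_mul_left hmul hα, I.Psi_le (I.BR_subset_dBR hδ p hb)]

lemma Psi_towardReward_ge (I : PAInstance A O) {δ α : ℝ} (hδ : 0 < δ) (h0 : 0 < α)
    (h1 : α ≤ 1) {p : O → ℝ} (hp : IsContract p) :
    I.Psi δ p - 2 * α + α ^ 2 ≤ I.Psi (δ + α ^ 2) (I.towardReward α p) := by
  refine le_csInf ((I.dBR_nonempty (by positivity) _).image _) ?_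
  rintro _ ⟨a, ha, rfl⟩
  rw [uP_towardReward]
  have h₁ := mul_le_mul_of_nonneg_left (I.Psi_sub_le_uP_of_mem_dBR hδ h0 ha)
    (sub_nonneg.2 h1)
  have h₂ := mul_le_mul_of_nonneg_left (I.Psi_le_one hδ hp) h0.le
  linarith

end PAInstance

/-- `OPT(δ + ε) ≥ OPT(δ) - 2√ε + ε`. -/
theorem opt_robust_shift {A O : Type*} [Fintype A] [Fintype O] [Nonempty A] [Nonempty O]
    (I : PAInstance A O) (δ ε : ℝ) (hδ : δ ∈ Set.Ioo (0 : ℝ) 1)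
    (hε : ε ∈ Set.Ioo (0 : ℝ) 1) (hsum : δ + ε < 1) :
    I.OPTrob (δ + ε) ≥ I.OPTrob δ - 2 * Real.sqrt ε + ε := by
  have h0 : 0 < √ε := Real.sqrt_pos.2 hε.1
  have h1 : √ε ≤ 1 := Real.sqrt_le_one.2 hε.2.le
  have hsq : √ε ^ 2 = ε := Real.sq_sqrt hε.1.le
  suffices h : I.OPTrob δ ≤ I.OPTrob (δ + ε) + 2 * √ε - ε by linarith
  refine csSup_le ⟨_, 0, fun _ => le_rfl, rfl⟩ ?_
  rintro _ ⟨p, hp, rfl⟩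
  have hshift := I.Psi_towardReward_ge hδ.1 h0 h1 hp
  rw [hsq] at hshift
  have hopt := I.Psi_le_OPTrob (add_pos hδ.1 hε.1) (I.isContract_towardReward h0.le h1 hp)
  linarith
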